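/- arXiv:1908.08225 — 8 statements merged into one kernel-verified Lean document; each statement's English description precedes it below -/
import Mathlib

section
/- Let M be a monoid. If x is a left unit of M and x lies in F_R(M), then x is a unit of M; that is, Gₗ(M) ∩ F_R(M) = G(M). Consequently also Gₗ(M) ∩ F(M) = G(M). -/
/-- The set of idempotents of a monoid. -/
def Eset (M : Type*) [Monoid M] : Set M := {e | e * e = e}

/-- The set of left units of a monoid. -/
def Gl (M : Type*) [Monoid M] : Set M := {x | ∃ a, a * x = 1}

/-- The set of right units of a monoid. -/
def Gr (M : Type*) [Monoid M] : Set M := {x | ∃ a, x * a = 1}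

/-- The set of (two-sided) units of a monoid. -/
def G (M : Type*) [Monoid M] : Set M := Gl M ∩ Gr M

/-- The submonoid generated by the idempotents. -/
def EE (M : Type*) [Monoid M] : Submonoid M := Submonoid.closure (Eset M)

/-- The submonoid generated by the one-sided units. -/
def GLR (M : Type*) [Monoid M] : Submonoid M := Submonoid.closure (Gl M ∪ Gr M)

/-- The submonoid generated by the idempotents and units. -/
def F (M : Type*) [Monoid M] : Submonoid M := Submonoid.closure (Eset M ∪ G M)

/-- The submonoid generated by the idempotents and left units. -/
def FL (M : Type*) [Monoid M] : Submonoid M := Submonoid.closure (Eset M ∪ Gl M)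

/-- The submonoid generated by the idempotents and right units. -/
def FR (M : Type*) [Monoid M] : Submonoid M := Submonoid.closure (Eset M ∪ Gr M)

/-- The submonoid generated by the idempotents and one-sided units. -/
def FLR (M : Type*) [Monoid M] : Submonoid M := Submonoid.closure (Eset M ∪ Gl M ∪ Gr M)
/-- A left unit that is a product of idempotents and right units is a right unit. -/
theorem mem_Gr_of_mem_Gl_of_mem_FR {M : Type*} [Monoid M] {x : M} (hl : x ∈ Gl M)
    (hx : x ∈ FR M) : x ∈ Gr M := by
  revert hl
  refine Submonoid.closure_induction_right (motive := fun x _ => x ∈ Gl M → x ∈ Gr M)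
    (fun _ => ⟨1, one_mul 1⟩) ?_ hx
  rintro x - y hy ih ⟨a, ha⟩
  have hy' : y ∈ Gr M := by
    rcases hy with hy | hy
    · have hy : y * y = y := hy
      have h : y = 1 := by
        calc y = a * (x * y) * y := by rw [ha, one_mul]
          _ = 1 := by rw [mul_assoc, mul_assoc, hy, ha]
      exact ⟨1, by rw [h, one_mul]⟩
    · exact hy
  obtain ⟨b, hb⟩ := hy'
  have hab : a * x = b := by
    calc a * x = a * x * (y * b) := by rw [hb, mul_one]
      _ = a * (x * y) * b := by simp only [mul_assoc]
      _ = b := by rw [ha, one_mul]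
  obtain ⟨c, hc⟩ := ih ⟨y * a, by rw [mul_assoc, hab, hb]⟩
  exact ⟨b * c, by rw [mul_assoc, ← mul_assoc y, hb, one_mul, hc]⟩

theorem stmt_1 (M : Type*) [Monoid M] :
    (∀ x ∈ Gl M, x ∈ FR M → x ∈ G M) ∧
    Gl M ∩ (FR M : Set M) = G M ∧ Gl M ∩ (F M : Set M) = G M := by
  have h : ∀ x ∈ Gl M, x ∈ FR M → x ∈ G M := fun x hl hx =>
    ⟨hl, mem_Gr_of_mem_Gl_of_mem_FR hl hx⟩
  have hF : F M ≤ FR M :=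
    Submonoid.closure_mono (Set.union_subset_union_right _ Set.inter_subset_right)
  refine ⟨h, Set.Subset.antisymm (fun x hx => h x hx.1 hx.2) fun x hx => ⟨hx.1, ?_⟩,
    Set.Subset.antisymm (fun x hx => h x hx.1 (hF hx.2)) fun x hx => ⟨hx.1, ?_⟩⟩
  · exact Submonoid.subset_closure (Or.inr hx.2)
  · exact Submonoid.subset_closure (Or.inr hx)
end

section
/- Let M be a monoid. If M has a left unit that is not a unit, then the set of idempotents of M lying in G_LR(M) is infinite. -/
theorem pow_mul_pow_injective_of_mul_eq_one {M : Type*} [Monoid M] {a x : M} (hax : a * x = 1)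
    (hx : ∀ b, x * b ≠ 1) : Function.Injective fun n : ℕ => x ^ n * a ^ n := by
  refine .of_lt_imp_ne fun m n hmn heq => ?_
  obtain ⟨k, rfl⟩ := Nat.exists_eq_add_of_lt hmn
  have hm : a ^ m * x ^ m = 1 := pow_mul_pow_eq_one m hax
  refine hx (x ^ k * a ^ (k + 1)) ?_
  calc x * (x ^ k * a ^ (k + 1))
      = x ^ (k + 1) * a ^ (k + 1) := by rw [pow_succ' x, mul_assoc]
    _ = (a ^ m * x ^ m) * (x ^ (k + 1) * a ^ (k + 1)) * (a ^ m * x ^ m) := by simp [hm]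
    _ = a ^ m * (x ^ (m + (k + 1)) * a ^ ((k + 1) + m)) * x ^ m := by
        simp only [pow_add _ m (k + 1), pow_add _ (k + 1) m, mul_assoc]
    _ = a ^ m * (x ^ m * a ^ m) * x ^ m := by
        rw [add_comm (k + 1) m]
        exact congrArg (fun y => a ^ m * y * x ^ m) heq.symm
    _ = (a ^ m * x ^ m) * (a ^ m * x ^ m) := by simp only [mul_assoc]
    _ = 1 := by rw [hm, one_mul]

theorem stmt_3 (M : Type*) [Monoid M] (h : ∃ x, x ∈ Gl M ∧ x ∉ G M) :
    {e : M | e ∈ GLR M ∧ e * e = e}.Infinite := by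
  obtain ⟨x, ⟨a, hax⟩, hG⟩ := h
  have hx : ∀ b, x * b ≠ 1 := fun b hb => hG ⟨⟨a, hax⟩, ⟨b, hb⟩⟩
  refine Set.infinite_of_injective_forall_mem (pow_mul_pow_injective_of_mul_eq_one hax hx)
    fun n => ⟨?_, ?_⟩
  · have hxm : x ∈ GLR M := Submonoid.subset_closure (Or.inl ⟨a, hax⟩)
    have ham : a ∈ GLR M := Submonoid.subset_closure (Or.inr ⟨x, hax⟩)
    exact mul_mem (pow_mem hxm n) (pow_mem ham n)
  · calc x ^ n * a ^ n * (x ^ n * a ^ n) = x ^ n * (a ^ n * x ^ n) * a ^ n := by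
          simp only [mul_assoc]
      _ = x ^ n * a ^ n := by rw [pow_mul_pow_eq_one n hax, mul_one]
end

section
/- Let M be a monoid and suppose a, x ∈ M satisfy a*x = 1 and x*a ≠ 1. Then for every natural number m the element x^m * a^m is idempotent, and the map m ↦ x^m * a^m from ℕ to M is injective; in particular M contains infinitely many idempotents. -/
theorem pow_mul_pow_mul_self {M : Type*} [Monoid M] {a x : M} (h : a * x = 1) (m : ℕ) :
    (x ^ m * a ^ m) * (x ^ m * a ^ m) = x ^ m * a ^ m := by
  rw [mul_assoc, ← mul_assoc (a ^ m), pow_mul_pow_eq_one m h, one_mul]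

theorem pow_mul_pow_ne_of_lt {M : Type*} [Monoid M] {a x : M} (h : a * x = 1)
    (h' : x * a ≠ 1) {m n : ℕ} (hmn : m < n) : x ^ m * a ^ m ≠ x ^ n * a ^ n := by
  intro e
  obtain ⟨k, rfl⟩ := Nat.exists_eq_add_of_lt hmn
  have hm := pow_mul_pow_eq_one m h
  have key : x ^ (k + 1) * a ^ (k + 1) = 1 := by
    calc x ^ (k + 1) * a ^ (k + 1)
        = (a ^ m * x ^ m) * (x ^ (k + 1) * a ^ (k + 1)) * (a ^ m * x ^ m) := by simp [hm]
      _ = a ^ m * (x ^ (m + k + 1) * a ^ (m + k + 1)) * x ^ m := by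
        rw [add_assoc m k 1, pow_add x m, add_comm m, pow_add a (k + 1)]
        simp only [mul_assoc]
      _ = (a ^ m * x ^ m) * (a ^ m * x ^ m) := by rw [← e]; simp only [mul_assoc]
      _ = 1 := by rw [hm, one_mul]
  rw [pow_succ', mul_assoc] at key
  exact h' (by rwa [← left_inv_eq_right_inv h key] at key)

theorem pow_mul_pow_injective {M : Type*} [Monoid M] {a x : M} (h : a * x = 1)
    (h' : x * a ≠ 1) : Function.Injective (fun m : ℕ => x ^ m * a ^ m) :=
  .of_lt_imp_ne fun _ _ hmn => pow_mul_pow_ne_of_lt h h' hmn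

theorem stmt_4 (M : Type*) [Monoid M] (a x : M) (h1 : a * x = 1) (h2 : x * a ≠ 1) :
    (∀ m : ℕ, (x ^ m * a ^ m) * (x ^ m * a ^ m) = x ^ m * a ^ m) ∧
    Function.Injective (fun m : ℕ => x ^ m * a ^ m) ∧
    {e : M | e * e = e}.Infinite :=
  ⟨pow_mul_pow_mul_self h1, pow_mul_pow_injective h1 h2,
    Set.infinite_of_injective_forall_mem (pow_mul_pow_injective h1 h2)
      (pow_mul_pow_mul_self h1)⟩
end

section
/- Let M be a monoid. Then G_LR(M) contains an idempotent different from 1 if and only if M has a left unit that is not a unit. -/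
/-- If every left unit is a unit, then every product of one-sided units is a unit. -/
theorem isUnit_of_mem_GLR {M : Type*} [Monoid M] (h : Gl M ⊆ G M) {x : M} (hx : x ∈ GLR M) :
    IsUnit x := by
  have left {y a : M} (hay : a * y = 1) : IsUnit y := by
    obtain ⟨-, b, hyb⟩ := h ⟨a, hay⟩
    exact isUnit_iff_exists.2 ⟨b, hyb, left_inv_eq_right_inv hay hyb ▸ hay⟩
  refine (Submonoid.closure_le (S := IsUnit.submonoid M)).2 ?_ hx
  rintro y (⟨a, hay⟩ | ⟨a, hya⟩)
  · exact left hay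
  · obtain ⟨u, rfl⟩ := left hya
    exact Units.eq_inv_of_mul_eq_one_right hya ▸ u⁻¹.isUnit

theorem stmt_5 (M : Type*) [Monoid M] :
    (∃ e ∈ GLR M, e * e = e ∧ e ≠ 1) ↔ ∃ x, x ∈ Gl M ∧ x ∉ G M := by
  constructor
  · rintro ⟨e, he, hee, hne⟩
    by_contra! h
    exact hne ((isUnit_of_mem_GLR h he).mul_eq_left.1 hee)
  · rintro ⟨x, ⟨a, hax⟩, hx⟩
    refine ⟨x * a, mul_mem (Submonoid.subset_closure (.inl ⟨a, hax⟩))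
      (Submonoid.subset_closure (.inr ⟨x, hax⟩)), ?_, fun hxa => hx ⟨⟨a, hax⟩, a, hxa⟩⟩
    rw [mul_assoc, ← mul_assoc a, hax, one_mul]
end

section
/- Let M be a monoid. Then F(M) = F_L(M) if and only if every left unit of M is a unit. -/
/-- In the submonoid generated by the idempotents and units, every left unit is a unit. -/
theorem mem_Gr_of_mem_F_of_mem_Gl {M : Type*} [Monoid M] {x : M} (hx : x ∈ F M)
    (hl : x ∈ Gl M) : x ∈ Gr M := by
  induction hx using Submonoid.closure_induction_right with
  | one => exact ⟨1, mul_one 1⟩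
  | mul_right y _ s hs ih =>
    obtain ⟨a, ha⟩ := hl
    have has : a * y * s = 1 := by rw [mul_assoc, ha]
    rcases hs with he | ⟨-, b, hb⟩
    · have hs1 : s = 1 := by
        calc s = a * y * s * s := by rw [has, one_mul]
          _ = a * y * s := by rw [mul_assoc, show s * s = s from he]
          _ = 1 := has
      subst hs1
      rw [mul_one] at has ⊢
      exact ih ⟨a, has⟩
    · have hay : a * y = b := left_inv_eq_right_inv has hb
      obtain ⟨c, hc⟩ := ih ⟨s * a, by rw [mul_assoc, hay, hb]⟩
      exact ⟨b * c, by rw [mul_assoc, ← mul_assoc s, hb, one_mul, hc]⟩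

theorem stmt_6 (M : Type*) [Monoid M] :
    F M = FL M ↔ ∀ x ∈ Gl M, x ∈ G M := by
  constructor
  · intro h x hx
    have hxF : x ∈ F M := h ▸ Submonoid.subset_closure (Or.inr hx)
    exact ⟨hx, mem_Gr_of_mem_F_of_mem_Gl hxF hx⟩
  · intro h
    have hG : G M = Gl M := Set.Subset.antisymm Set.inter_subset_left h
    rw [F, FL, hG]
end

section
/- Let M be a monoid. The set of submonoids {{1}, 𝔼(M), G(M), Gₗ(M), Gᵣ(M), G_LR(M), F(M), F_L(M), F_R(M), F_LR(M), M} is closed under the join operation S ⊔ T = ⟨S ∪ T⟩ in the lattice of submonoids of M. -/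
/-- In a join-semilattice with bottom and top, given elements `g ≤ l` and `g ≤ r` and any `e`, the
joins of subsets of `{e, g, l, r}`, together with `⊤`, are closed under binary joins. -/
theorem sup_mem_of_le_of_le {α : Type*} [SemilatticeSup α] [BoundedOrder α] {e g l r : α}
    (hl : g ≤ l) (hr : g ≤ r) {A : Set α}
    (hA : A = {⊥, e, g, l, r, l ⊔ r, e ⊔ g, e ⊔ l, e ⊔ r, e ⊔ l ⊔ r, ⊤}) :
    ∀ S ∈ A, ∀ T ∈ A, S ⊔ T ∈ A := by
  have hgl : g ⊔ l = l := sup_eq_right.2 hl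
  have hgr : g ⊔ r = r := sup_eq_right.2 hr
  have closed (x : α) (hx : x = e ∨ x = g ∨ x = l ∨ x = r) : ∀ T ∈ A, x ⊔ T ∈ A := by
    intro T hT
    simp only [hA, Set.mem_insert_iff, Set.mem_singleton_iff] at hT ⊢
    rcases hx with rfl | rfl | rfl | rfl <;>
      rcases hT with rfl | rfl | rfl | rfl | rfl | rfl | rfl | rfl | rfl | rfl | rfl <;>
      grind [sup_bot_eq, sup_top_eq]
  have he := closed e (by simp)
  have hg := closed g (by simp)
  have hl' := closed l (by simp)
  have hr' := closed r (by simp)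
  intro S hS T hT
  have htop : ⊤ ∈ A := by simp [hA]
  simp only [hA, Set.mem_insert_iff, Set.mem_singleton_iff] at hS
  clear hA closed
  rcases hS with rfl | rfl | rfl | rfl | rfl | rfl | rfl | rfl | rfl | rfl | rfl <;>
    try simp only [sup_assoc, bot_sup_eq, top_sup_eq]
  all_goals solve_by_elim

theorem stmt_11 (M : Type*) [Monoid M] :
    ∀ S ∈ ({⊥, EE M, Submonoid.closure (G M), Submonoid.closure (Gl M),
        Submonoid.closure (Gr M), GLR M, F M, FL M, FR M, FLR M, ⊤} : Set (Submonoid M)),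
    ∀ T ∈ ({⊥, EE M, Submonoid.closure (G M), Submonoid.closure (Gl M),
        Submonoid.closure (Gr M), GLR M, F M, FL M, FR M, FLR M, ⊤} : Set (Submonoid M)),
    S ⊔ T ∈ ({⊥, EE M, Submonoid.closure (G M), Submonoid.closure (Gl M),
        Submonoid.closure (Gr M), GLR M, F M, FL M, FR M, FLR M, ⊤} : Set (Submonoid M)) := by
  refine sup_mem_of_le_of_le (e := EE M)
    (Submonoid.closure_mono Set.inter_subset_left : Submonoid.closure (G M) ≤ _)
    (Submonoid.closure_mono Set.inter_subset_right : Submonoid.closure (G M) ≤ _) ?_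
  simp only [EE, GLR, F, FL, FR, FLR, Submonoid.closure_union]
end

section
/- Let M be a monoid and let N denote the monoid G_LR(M). Then the submonoid of N generated by the idempotents of N together with the units of N is all of N if and only if every left unit of M is a unit. (In the paper's notation: P(M) = G_LR(M) if and only if G(M) = Gₗ(M).) -/
/-- A left unit that is a product of idempotents and units is a right unit. -/
theorem exists_right_inv_of_mem_closure {N : Type*} [Monoid N] {x : N}
    (hx : x ∈ Submonoid.closure ({e : N | e * e = e}
        ∪ {x : N | (∃ a, a * x = 1) ∧ ∃ a, x * a = 1})) :
    (∃ a, a * x = 1) → ∃ a, x * a = 1 := by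
  induction hx using Submonoid.closure_induction_right with
  | one => exact fun _ => ⟨1, one_mul 1⟩
  | mul_right y _ s hs ih =>
    rintro ⟨a, ha⟩
    rcases hs with he | ⟨-, t, ht⟩
    · have hs1 : s = 1 := by
        calc s = a * (y * s) * s := by rw [ha, one_mul]
          _ = a * (y * (s * s)) := by simp only [mul_assoc]
          _ = 1 := by rw [show s * s = s from he, ha]
      subst hs1
      rw [mul_one] at ha ⊢
      exact ih ⟨a, ha⟩
    · have hy : s * a * y = 1 := by
        calc s * a * y = s * a * (y * (s * t)) := by rw [ht, mul_one]
          _ = s * (a * (y * s)) * t := by simp only [mul_assoc]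
          _ = 1 := by rw [ha, mul_one, ht]
      obtain ⟨b, hb⟩ := ih ⟨s * a, hy⟩
      exact ⟨t * b, by rw [mul_assoc, ← mul_assoc s, ht, one_mul, hb]⟩

/-- If every left unit is a unit, then every right unit is a unit. -/
theorem mem_G_of_mem_Gr {M : Type*} [Monoid M] (h : ∀ x ∈ Gl M, x ∈ G M)
    {x : M} (hx : x ∈ Gr M) : x ∈ G M := by
  obtain ⟨a, ha⟩ := hx
  obtain ⟨-, b, hb⟩ := h a ⟨x, ha⟩
  have hxb : x = b := left_inv_eq_right_inv ha hb
  exact ⟨⟨a, hxb ▸ hb⟩, ⟨a, ha⟩⟩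

/-- If every left unit is a unit, then so is every product of one-sided units. -/
theorem mem_G_of_mem_GLR {M : Type*} [Monoid M] (h : ∀ x ∈ Gl M, x ∈ G M)
    {x : M} (hx : x ∈ GLR M) : x ∈ G M := by
  induction hx using Submonoid.closure_induction with
  | mem y hy => exact hy.elim (h y) (mem_G_of_mem_Gr h)
  | one => exact ⟨⟨1, one_mul 1⟩, ⟨1, one_mul 1⟩⟩
  | mul y z _ _ hy hz =>
    obtain ⟨⟨a, ha⟩, -⟩ := hy
    obtain ⟨⟨b, hb⟩, -⟩ := hz
    exact h _ ⟨b * a, by rw [mul_assoc, ← mul_assoc a, ha, one_mul, hb]⟩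

theorem stmt_17 (M : Type*) [Monoid M] :
    (Submonoid.closure ({e : GLR M | e * e = e}
        ∪ {x : GLR M | (∃ a, a * x = 1) ∧ ∃ a, x * a = 1}) = ⊤)
      ↔ ∀ x ∈ Gl M, x ∈ G M := by
  constructor
  · rintro h x ⟨a, ha⟩
    have hxN : x ∈ GLR M := Submonoid.subset_closure (Or.inl ⟨a, ha⟩)
    have haN : a ∈ GLR M := Submonoid.subset_closure (Or.inr ⟨x, ha⟩)
    obtain ⟨b, hb⟩ := exists_right_inv_of_mem_closure (x := (⟨x, hxN⟩ : GLR M))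
      (h ▸ Submonoid.mem_top _) ⟨⟨a, haN⟩, Subtype.ext ha⟩
    exact ⟨⟨a, ha⟩, ⟨b, congrArg Subtype.val hb⟩⟩
  · refine fun h => eq_top_iff.2 fun x _ => Submonoid.subset_closure (Or.inr ?_)
    obtain ⟨⟨a, ha⟩, ⟨b, hb⟩⟩ := mem_G_of_mem_GLR h x.2
    have haN : a ∈ GLR M := Submonoid.subset_closure (Or.inr ⟨x, ha⟩)
    have hbN : b ∈ GLR M := Submonoid.subset_closure (Or.inl ⟨x, hb⟩)
    exact ⟨⟨⟨a, haN⟩, Subtype.ext ha⟩, ⟨⟨b, hbN⟩, Subtype.ext hb⟩⟩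
end

section
/- For every quadruple (i, j, k, l) of Boolean values there exists a monoid M such that: i holds if and only if every left unit of M is a unit; j holds if and only if F_LR(M) = M; k holds if and only if F_LR(M) = G_LR(M); and l holds if and only if the group of units of M is trivial. -/
/-- The truth values of the four properties of `M` are `i`, `j`, `k`, `l`. -/
def HasTruthValues (M : Type) [Monoid M] (i j k l : Bool) : Prop :=
  (i = true ↔ ∀ x ∈ Gl M, x ∈ G M) ∧ (j = true ↔ FLR M = ⊤) ∧
    (k = true ↔ FLR M = GLR M) ∧ (l = true ↔ G M = ({1} : Set M))

section Prod

variable {M N : Type*} [Monoid M] [Monoid N]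

theorem mem_Gl_prod {x : M × N} : x ∈ Gl (M × N) ↔ x.1 ∈ Gl M ∧ x.2 ∈ Gl N := by
  simp [Gl, Prod.ext_iff]

theorem mem_Gr_prod {x : M × N} : x ∈ Gr (M × N) ↔ x.1 ∈ Gr M ∧ x.2 ∈ Gr N := by
  simp [Gr, Prod.ext_iff]

theorem mem_G_prod {x : M × N} : x ∈ G (M × N) ↔ x.1 ∈ G M ∧ x.2 ∈ G N := by
  simp only [G, Set.mem_inter_iff, mem_Gl_prod, mem_Gr_prod]
  tauto

theorem mem_Eset_prod {x : M × N} : x ∈ Eset (M × N) ↔ x.1 ∈ Eset M ∧ x.2 ∈ Eset N := by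
  simp [Eset, Prod.ext_iff]

theorem one_mem_Eset : (1 : M) ∈ Eset M := mul_one 1

theorem one_mem_Gl : (1 : M) ∈ Gl M := ⟨1, mul_one 1⟩

theorem one_mem_Gr : (1 : M) ∈ Gr M := ⟨1, mul_one 1⟩

theorem one_mem_G : (1 : M) ∈ G M := ⟨one_mem_Gl, one_mem_Gr⟩

theorem closure_eq_prod {S : Set (M × N)} {A : Set M} {B : Set N}
    (hS : ∀ x ∈ S, x.1 ∈ A ∧ x.2 ∈ B) (hA : ∀ a ∈ A, (a, 1) ∈ S) (hB : ∀ b ∈ B, (1, b) ∈ S) :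
    Submonoid.closure S = (Submonoid.closure A).prod (Submonoid.closure B) := by
  apply le_antisymm
  · rw [Submonoid.closure_le]
    exact fun x hx => ⟨Submonoid.subset_closure (hS x hx).1, Submonoid.subset_closure (hS x hx).2⟩
  · rw [Submonoid.prod_le_iff, Submonoid.map_le_iff_le_comap, Submonoid.map_le_iff_le_comap,
      Submonoid.closure_le, Submonoid.closure_le]
    exact ⟨fun a ha => Submonoid.subset_closure (hA a ha),
      fun b hb => Submonoid.subset_closure (hB b hb)⟩

theorem FLR_prod : FLR (M × N) = (FLR M).prod (FLR N) := by
  refine closure_eq_prod ?_ ?_ ?_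
  · simp only [Set.mem_union, mem_Eset_prod, mem_Gl_prod, mem_Gr_prod]
    tauto
  all_goals
    simp only [Set.mem_union, mem_Eset_prod, mem_Gl_prod, mem_Gr_prod, one_mem_Eset, one_mem_Gl,
      one_mem_Gr]
    tauto

theorem GLR_prod : GLR (M × N) = (GLR M).prod (GLR N) := by
  refine closure_eq_prod ?_ ?_ ?_
  · simp only [Set.mem_union, mem_Gl_prod, mem_Gr_prod]
    tauto
  all_goals
    simp only [Set.mem_union, mem_Gl_prod, mem_Gr_prod, one_mem_Gl, one_mem_Gr]
    tauto

theorem Submonoid.prod_eq_prod_iff {A C : Submonoid M} {B D : Submonoid N} :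
    A.prod B = C.prod D ↔ A = C ∧ B = D := by
  refine ⟨fun h => ⟨?_, ?_⟩, fun ⟨h, h'⟩ => by rw [h, h']⟩
  · ext a
    simpa [Submonoid.mem_prod, one_mem] using SetLike.ext_iff.1 h (a, 1)
  · ext b
    simpa [Submonoid.mem_prod, one_mem] using SetLike.ext_iff.1 h (1, b)

end Prod

theorem HasTruthValues.prod {M N : Type} [Monoid M] [Monoid N] {i j k l i' j' k' l' : Bool}
    (hM : HasTruthValues M i j k l) (hN : HasTruthValues N i' j' k' l') :
    HasTruthValues (M × N) (i && i') (j && j') (k && k') (l && l') := by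
  obtain ⟨hi, hj, hk, hl⟩ := hM
  obtain ⟨hi', hj', hk', hl'⟩ := hN
  refine ⟨?_, ?_, ?_, ?_⟩
  · rw [Bool.and_eq_true, hi, hi']
    refine ⟨fun h x hx => ?_, fun h => ⟨fun a ha => ?_, fun b hb => ?_⟩⟩
    · rw [mem_Gl_prod] at hx
      exact mem_G_prod.2 ⟨h.1 _ hx.1, h.2 _ hx.2⟩
    · exact (mem_G_prod.1 (h (a, 1) (mem_Gl_prod.2 ⟨ha, one_mem_Gl⟩))).1
    · exact (mem_G_prod.1 (h (1, b) (mem_Gl_prod.2 ⟨one_mem_Gl, hb⟩))).2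
  · rw [Bool.and_eq_true, hj, hj', FLR_prod, ← Submonoid.top_prod_top,
      Submonoid.prod_eq_prod_iff]
  · rw [Bool.and_eq_true, hk, hk', FLR_prod, GLR_prod, Submonoid.prod_eq_prod_iff]
  · have hG : G (M × N) = G M ×ˢ G N := Set.ext fun _ => mem_G_prod
    have hone : ({1} : Set (M × N)) = {1} ×ˢ {1} := by rw [Set.singleton_prod_singleton]; rfl
    rw [Bool.and_eq_true, hl, hl', hG, hone,
      Set.prod_eq_prod_iff_of_nonempty ⟨(1, 1), one_mem_G, one_mem_G⟩]

section Commutative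

variable {M : Type*} [CommMonoid M]

theorem mem_Gl_iff_isUnit {x : M} : x ∈ Gl M ↔ IsUnit x :=
  isUnit_iff_exists_inv'.symm

theorem mem_Gr_iff_isUnit {x : M} : x ∈ Gr M ↔ IsUnit x :=
  isUnit_iff_exists_inv.symm

theorem mem_G_iff_isUnit {x : M} : x ∈ G M ↔ IsUnit x := by
  simp [G, mem_Gl_iff_isUnit, mem_Gr_iff_isUnit]

theorem G_eq_singleton_one [Subsingleton Mˣ] : G M = {1} := by
  ext x
  simp [mem_G_iff_isUnit]

theorem GLR_eq_bot [Subsingleton Mˣ] : GLR M = ⊥ := by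
  rw [GLR, eq_bot_iff, Submonoid.closure_le]
  intro x hx
  simpa [mem_Gl_iff_isUnit, mem_Gr_iff_isUnit] using hx

end Commutative

theorem hasTruthValues_unit : HasTruthValues Unit true true true true :=
  ⟨by simp [mem_G_iff_isUnit], by simp [eq_iff_true_of_subsingleton],
    by simp [eq_iff_true_of_subsingleton], by simp [G_eq_singleton_one]⟩

/-- The bicyclic monoid: the pair `(a, b)` stands for `q ^ a * p ^ b`, where `p * q = 1`. -/
@[ext]
structure Bicyclic where
  a : ℕ
  b : ℕ

namespace Bicyclic

instance : Monoid Bicyclic where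
  one := ⟨0, 0⟩
  mul x y := ⟨x.a + (y.a - x.b), y.b + (x.b - y.a)⟩
  mul_assoc x y z := by
    apply Bicyclic.ext
    · change x.a + (y.a - x.b) + (z.a - (y.b + (x.b - y.a))) = x.a + (y.a + (z.a - y.b) - x.b)
      omega
    · change z.b + (y.b + (x.b - y.a) - z.a) = z.b + (y.b - z.a) + (x.b - (y.a + (z.a - y.b)))
      omega
  one_mul x := by
    apply Bicyclic.ext
    · change 0 + (x.a - 0) = x.a
      omega
    · change x.b + (0 - x.a) = x.b
      omega
  mul_one x := by
    apply Bicyclic.ext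
    · change x.a + (0 - x.b) = x.a
      omega
    · change 0 + (x.b - 0) = x.b
      omega

theorem mul_def (x y : Bicyclic) : x * y = ⟨x.a + (y.a - x.b), y.b + (x.b - y.a)⟩ := rfl

theorem one_def : (1 : Bicyclic) = ⟨0, 0⟩ := rfl

theorem mem_Gl_iff {x : Bicyclic} : x ∈ Gl Bicyclic ↔ x.b = 0 := by
  refine ⟨fun ⟨y, hy⟩ => ?_, fun h => ⟨⟨0, x.a⟩, ?_⟩⟩
  · rw [mul_def, one_def, Bicyclic.mk.injEq] at hy
    omega
  · simp [mul_def, one_def, h]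

theorem mem_Gr_iff {x : Bicyclic} : x ∈ Gr Bicyclic ↔ x.a = 0 := by
  refine ⟨fun ⟨y, hy⟩ => ?_, fun h => ⟨⟨x.b, 0⟩, ?_⟩⟩
  · rw [mul_def, one_def, Bicyclic.mk.injEq] at hy
    omega
  · simp [mul_def, one_def, h]

theorem GLR_eq_top : GLR Bicyclic = ⊤ := by
  refine eq_top_iff.2 fun x _ => ?_
  have hx : x = ⟨x.a, 0⟩ * ⟨0, x.b⟩ := by simp [mul_def]
  rw [hx]
  exact mul_mem (Submonoid.subset_closure (Or.inl (mem_Gl_iff.2 rfl)))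
    (Submonoid.subset_closure (Or.inr (mem_Gr_iff.2 rfl)))

end Bicyclic

theorem GLR_le_FLR (M : Type*) [Monoid M] : GLR M ≤ FLR M :=
  Submonoid.closure_mono (Set.union_subset_union_left _ Set.subset_union_right)

theorem hasTruthValues_bicyclic : HasTruthValues Bicyclic false true true true := by
  have hF : FLR Bicyclic = ⊤ := top_le_iff.1 (Bicyclic.GLR_eq_top ▸ GLR_le_FLR Bicyclic)
  refine ⟨?_, by simp [hF], by simp [hF, Bicyclic.GLR_eq_top], ?_⟩
  · have h : (⟨1, 0⟩ : Bicyclic) ∈ Gl Bicyclic := Bicyclic.mem_Gl_iff.2 rfl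
    simp only [Bool.false_eq_true, false_iff]
    intro hG
    exact one_ne_zero (Bicyclic.mem_Gr_iff.1 (hG _ h).2)
  · simp only [true_iff]
    ext x
    simp [G, Bicyclic.mem_Gl_iff, Bicyclic.mem_Gr_iff, Bicyclic.one_def, Bicyclic.ext_iff, and_comm]

theorem hasTruthValues_multiplicative_nat :
    HasTruthValues (Multiplicative ℕ) true false true true := by
  have hF : FLR (Multiplicative ℕ) = ⊥ := by
    rw [FLR, eq_bot_iff, Submonoid.closure_le]
    intro x hx
    simpa [mem_Gl_iff_isUnit, mem_Gr_iff_isUnit, Eset] using hx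
  exact ⟨by simp [mem_G_iff_isUnit, mem_Gl_iff_isUnit], by simp [hF, bot_ne_top],
    by simp [hF, GLR_eq_bot], by simp [G_eq_singleton_one]⟩

theorem hasTruthValues_withZero_unit :
    HasTruthValues (WithZero Unit) true true false true := by
  have hu : ∀ x : WithZero Unit, x = 0 ∨ x = 1 := fun x => x.casesOn (Or.inl rfl) fun _ => Or.inr rfl
  have hsub : Subsingleton (WithZero Unit)ˣ :=
    ⟨fun x y => Units.ext (((hu x).resolve_left x.ne_zero).trans
      ((hu y).resolve_left y.ne_zero).symm)⟩
  have hF : FLR (WithZero Unit) = ⊤ := by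
    refine eq_top_iff.2 fun x _ => Submonoid.subset_closure (Or.inl (Or.inl ?_))
    rcases hu x with rfl | rfl <;> simp [Eset]
  exact ⟨by simp [mem_G_iff_isUnit, mem_Gl_iff_isUnit], by simp [hF],
    by simp [hF, GLR_eq_bot, top_ne_bot], by simp [G_eq_singleton_one]⟩

theorem hasTruthValues_units_int : HasTruthValues ℤˣ true true true false := by
  have hG : GLR ℤˣ = ⊤ := eq_top_iff.2 fun x _ =>
    Submonoid.subset_closure (Or.inl (mem_Gl_iff_isUnit.2 (Group.isUnit x)))
  have hF : FLR ℤˣ = ⊤ := top_le_iff.1 (hG ▸ GLR_le_FLR ℤˣ)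
  refine ⟨by simp [mem_G_iff_isUnit, mem_Gl_iff_isUnit], by simp [hF], by simp [hF, hG], ?_⟩
  simp only [Bool.false_eq_true, false_iff]
  intro h
  have h' : (-1 : ℤˣ) ∈ G ℤˣ := mem_G_iff_isUnit.2 (Group.isUnit _)
  rw [h] at h'
  exact absurd h' (by decide)

theorem stmt_19 (i j k l : Bool) :
    ∃ (M : Type) (inst : Monoid M),
      (i = true ↔ ∀ x ∈ @Gl M inst, x ∈ @G M inst) ∧
      (j = true ↔ @FLR M inst = ⊤) ∧
      (k = true ↔ @FLR M inst = @GLR M inst) ∧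
      (l = true ↔ @G M inst = ({1} : Set M)) := by
  have hi : ∃ (M : Type) (_ : Monoid M), HasTruthValues M i true true true := by
    cases i
    exacts [⟨_, _, hasTruthValues_bicyclic⟩, ⟨_, _, hasTruthValues_unit⟩]
  have hj : ∃ (M : Type) (_ : Monoid M), HasTruthValues M true j true true := by
    cases j
    exacts [⟨_, _, hasTruthValues_multiplicative_nat⟩, ⟨_, _, hasTruthValues_unit⟩]
  have hk : ∃ (M : Type) (_ : Monoid M), HasTruthValues M true true k true := by
    cases k
    exacts [⟨_, _, hasTruthValues_withZero_unit⟩, ⟨_, _, hasTruthValues_unit⟩]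
  have hl : ∃ (M : Type) (_ : Monoid M), HasTruthValues M true true true l := by
    cases l
    exacts [⟨_, _, hasTruthValues_units_int⟩, ⟨_, _, hasTruthValues_unit⟩]
  obtain ⟨A, _, hA⟩ := hi
  obtain ⟨B, _, hB⟩ := hj
  obtain ⟨C, _, hC⟩ := hk
  obtain ⟨D, _, hD⟩ := hl
  have h := (hA.prod hB).prod (hC.prod hD)
  simp only [Bool.and_true, Bool.true_and] at h
  exact ⟨_, _, h⟩
end
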